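/- For all real numbers x, y > 0, 2xy/(x + y) = (√(xy)/π) · ∫_0^π cos((1/π)·log(tan(z/2))·(log x − log y)) dz, and the integral converges. -/

import Mathlib

open Real intervalIntegral

/-- The beta integral `B(1/2 + ia/2, 1/2 - ia/2)` in trigonometric form. -/
lemma integral_cexp_mul_log_tan_half (a : ℝ) :
    ∫ z in Set.Ioo (0 : ℝ) π, Complex.exp ((a * log (tan (z / 2)) : ℝ) * Complex.I) =
      Complex.betaIntegral (1 / 2 + a / 2 * Complex.I) (1 / 2 - a / 2 * Complex.I) := by
  have himage : (fun z : ℝ => (1 - cos z) / 2) '' Set.Ioo 0 π = Set.Ioo 0 1 := by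
    ext u
    constructor
    · rintro ⟨z, ⟨hz0, hzπ⟩, rfl⟩
      have h1 := cos_lt_cos_of_nonneg_of_le_pi le_rfl hzπ.le hz0
      have h2 := cos_lt_cos_of_nonneg_of_le_pi hz0.le le_rfl hzπ
      rw [cos_zero] at h1
      rw [cos_pi] at h2
      constructor <;> dsimp only <;> linarith
    · rintro ⟨hu0, hu1⟩
      refine ⟨arccos (1 - 2 * u), ⟨arccos_pos.2 (by linarith), ?_⟩, ?_⟩
      · refine lt_of_le_of_ne (arccos_le_pi _) fun h => ?_
        rw [arccos_eq_pi] at h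
        linarith
      · dsimp only
        rw [cos_arccos (by linarith) (by linarith)]
        ring
  have hderiv : ∀ z ∈ Set.Ioo (0 : ℝ) π,
      HasDerivWithinAt (fun z : ℝ => (1 - cos z) / 2) (sin z / 2) (Set.Ioo 0 π) z := by
    intro z _
    simpa using (((hasDerivAt_cos z).const_sub 1).div_const 2).hasDerivWithinAt
  have hinj : Set.InjOn (fun z : ℝ => (1 - cos z) / 2) (Set.Ioo 0 π) := by
    intro z hz w hw h
    refine injOn_cos (Set.Ioo_subset_Icc_self hz) (Set.Ioo_subset_Icc_self hw) ?_
    dsimp only at h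
    linarith
  rw [Complex.betaIntegral, integral_of_le zero_le_one, MeasureTheory.integral_Ioc_eq_integral_Ioo,
    ← himage, MeasureTheory.integral_image_eq_integral_abs_deriv_smul measurableSet_Ioo hderiv hinj]
  refine MeasureTheory.setIntegral_congr_fun measurableSet_Ioo fun z hz => ?_
  obtain ⟨hz0, hzπ⟩ := hz
  have hS : 0 < sin (z / 2) := sin_pos_of_pos_of_lt_pi (by linarith) (by linarith)
  have hC : 0 < cos (z / 2) := cos_pos_of_mem_Ioo ⟨by linarith, by linarith⟩
  have hz : z = 2 * (z / 2) := by ring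
  have hf : (1 - cos z) / 2 = sin (z / 2) ^ 2 := by
    rw [hz, cos_two_mul, ← hz]
    linarith [sin_sq_add_cos_sq (z / 2)]
  have hg : (1 : ℂ) - (sin (z / 2) ^ 2 : ℝ) = (cos (z / 2) ^ 2 : ℝ) := by
    rw [cos_sq']
    push_cast
    ring
  have hd : |sin z / 2| = exp (log (sin (z / 2)) + log (cos (z / 2))) := by
    rw [exp_add, exp_log hS, exp_log hC, hz, sin_two_mul, ← hz, abs_of_pos (by positivity)]
    ring
  rw [hd, hf, hg, Complex.cpow_def_of_ne_zero (by exact_mod_cast (pow_pos hS 2).ne'),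
    Complex.cpow_def_of_ne_zero (by exact_mod_cast (pow_pos hC 2).ne'),
    ← Complex.ofReal_log (sq_nonneg _), ← Complex.ofReal_log (sq_nonneg _), log_pow, log_pow,
    Complex.real_smul, Complex.ofReal_exp, ← Complex.exp_add, ← Complex.exp_add,
    tan_eq_sin_div_cos, log_div hS.ne' hC.ne']
  congr 1
  push_cast
  ring

lemma betaIntegral_half_add_half_sub (a : ℝ) :
    Complex.betaIntegral (1 / 2 + a / 2 * Complex.I) (1 / 2 - a / 2 * Complex.I) =
      (π / cosh (π * a / 2) : ℝ) := by
  have h := Complex.Gamma_mul_Gamma_eq_betaIntegral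
    (s := 1 / 2 + a / 2 * Complex.I) (t := 1 / 2 - a / 2 * Complex.I) (by simp) (by simp)
  rw [show (1 / 2 + a / 2 * Complex.I) + (1 / 2 - a / 2 * Complex.I) = 1 by ring,
    Complex.Gamma_one, one_mul,
    show 1 / 2 - a / 2 * Complex.I = 1 - (1 / 2 + a / 2 * Complex.I) by ring,
    Complex.Gamma_mul_Gamma_one_sub,
    show π * (1 / 2 + a / 2 * Complex.I) = (π * a / 2 : ℂ) * Complex.I + π / 2 by ring,
    Complex.sin_add_pi_div_two, Complex.cos_mul_I] at h
  rw [show 1 / 2 - a / 2 * Complex.I = 1 - (1 / 2 + a / 2 * Complex.I) by ring, ← h]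
  push_cast
  rfl

lemma measurable_log_tan_half : Measurable fun z : ℝ => log (tan (z / 2)) := by
  simp only [tan_eq_sin_div_cos]
  fun_prop

lemma integral_cos_mul_log_tan_half (a : ℝ) :
    ∫ z in (0 : ℝ)..π, cos (a * log (tan (z / 2))) = π / cosh (π * a / 2) := by
  have hint : MeasureTheory.IntegrableOn
      (fun z : ℝ => Complex.exp ((a * log (tan (z / 2)) : ℝ) * Complex.I)) (Set.Ioo 0 π) := by
    refine MeasureTheory.Measure.integrableOn_of_bounded (M := 1) (by simp) ?_ ?_
    · have := measurable_log_tan_half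
      exact Measurable.aestronglyMeasurable (by fun_prop)
    · exact Filter.Eventually.of_forall fun z => (Complex.norm_exp_ofReal_mul_I _).le
  have h := congrArg Complex.re
    ((integral_cexp_mul_log_tan_half a).trans (betaIntegral_half_add_half_sub a))
  rw [Complex.ofReal_re, ← Complex.reCLM_apply, ← Complex.reCLM.integral_comp_comm hint] at h
  simpa only [Complex.reCLM_apply, Complex.exp_ofReal_mul_I_re,
    ← MeasureTheory.integral_Ioc_eq_integral_Ioo, ← integral_of_le pi_nonneg] using h

theorem chi2_periodic_integral_representation (x y : ℝ) (hx : 0 < x) (hy : 0 < y) :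
    IntervalIntegrable
        (fun z : ℝ =>
          Real.cos ((1 / π) * Real.log (Real.tan (z / 2)) * (Real.log x - Real.log y)))
        MeasureTheory.volume 0 π ∧
      2 * x * y / (x + y) =
        (Real.sqrt (x * y) / π) *
          ∫ z in (0 : ℝ)..π,
            Real.cos ((1 / π) * Real.log (Real.tan (z / 2)) * (Real.log x - Real.log y)) := by
  constructor
  · rw [intervalIntegrable_iff_integrableOn_Ioc_of_le pi_nonneg]
    refine MeasureTheory.Measure.integrableOn_of_bounded (M := 1) (by simp) ?_ ?_
    · have := measurable_log_tan_half
      exact Measurable.aestronglyMeasurable (by fun_prop)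
    · exact Filter.Eventually.of_forall fun z => abs_cos_le_one _
  · have hcosh : cosh ((log x - log y) / 2) = (x + y) / (2 * √(x * y)) := by
      have hx' : exp (log x / 2) = √x := by rw [exp_half, exp_log hx]
      have hy' : exp (log y / 2) = √y := by rw [exp_half, exp_log hy]
      have hsx : 0 < √x := sqrt_pos.2 hx
      have hsy : 0 < √y := sqrt_pos.2 hy
      rw [cosh_eq, neg_div', neg_sub, sub_div, sub_div, exp_sub, exp_sub, hx', hy',
        sqrt_mul hx.le]
      field_simp
      rw [sq_sqrt hx.le, sq_sqrt hy.le]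
    have h := integral_cos_mul_log_tan_half ((log x - log y) / π)
    rw [mul_div_cancel₀ _ pi_ne_zero, hcosh] at h
    rw [show (fun z : ℝ => cos ((1 / π) * log (tan (z / 2)) * (log x - log y))) =
      fun z : ℝ => cos ((log x - log y) / π * log (tan (z / 2))) by
        ext z; congr 1; ring, h]
    have hxy : √(x * y) ^ 2 = x * y := sq_sqrt (by positivity)
    have hs : 0 < √(x * y) := sqrt_pos.2 (by positivity)
    field_simp
    rw [hxy]
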